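/- For every k ≥ 0, every finite configuration ω ⊆ ℝ^d and every x ∈ ℝ^d, one has τ^{(k)}(x, ω) = τ^{(k)}(x, ω_e); that is, the iterate τ^{(k)}(x, ω) depends on the configuration ω only through the set ω_e of extreme points of its convex hull. -/

import Mathlib

noncomputable section

/-- `ℝ^d` with the Euclidean norm. -/
abbrev Rd (d : ℕ) := EuclideanSpace ℝ (Fin d)

/-- The induced transformation `τ_*` on configurations: `τ_* ω = {τ(x,ω) : x ∈ ω}`. -/
def tauStar {X : Type*} (τ : X → Set X → X) (ω : Set X) : Set X :=
  (fun x => τ x ω) '' ω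

/-- The iterates `τ^{(n)}`: `τ^{(0)}(x,ω) = x`,
`τ^{(n)}(x,ω) = τ^{(n-1)}(τ(x,ω), τ_* ω)`. -/
def tauIter {X : Type*} (τ : X → Set X → X) : ℕ → X → Set X → X
  | 0, x, _ => x
  | n + 1, x, ω => tauIter τ n (τ x ω) (tauStar τ ω)

/-- The set `ω_e` of extreme points of the convex hull of the configuration `ω`. -/
def extPts {d : ℕ} (ω : Set (Rd d)) : Set (Rd d) :=
  (convexHull ℝ ω).extremePoints ℝ

lemma line_closed_of_wbtw {d : ℕ} (g : Rd d → Rd d) (hg : Function.Injective g)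
    (hW : ∀ p z q, Wbtw ℝ p z q → Wbtw ℝ (g p) (g z) (g q))
    (S : AffineSubspace ℝ (Rd d)) (p q z : Rd d) (hp : g p ∈ S) (hq : g q ∈ S)
    (hz : Collinear ℝ ({p, z, q} : Set (Rd d))) (hpq : p ≠ q) : g z ∈ S := by
  have hcol : Collinear ℝ ({g p, g z, g q} : Set (Rd d)) := by
    rcases hz.wbtw_or_wbtw_or_wbtw with h | h | h
    · exact (hW _ _ _ h).collinear
    · have := (hW _ _ _ h).collinear
      refine this.subset ?_
      intro y; simp; tauto
    · have := (hW _ _ _ h).collinear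
      refine this.subset ?_
      intro y; simp; tauto
  have h1 : g z ∈ line[ℝ, g p, g q] :=
    hcol.mem_affineSpan_of_mem_of_ne (by simp) (by simp) (by simp) (hg.ne hpq)
  exact affineSpan_pair_le_of_mem_of_mem hp hq h1

/-- Preimage of an affine subspace under a betweenness-preserving injection. -/
def preSub {d : ℕ} (g : Rd d → Rd d) (hg : Function.Injective g)
    (hW : ∀ p z q, Wbtw ℝ p z q → Wbtw ℝ (g p) (g z) (g q))
    (S : AffineSubspace ℝ (Rd d)) : AffineSubspace ℝ (Rd d) where
  carrier := {x | g x ∈ S}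
  smul_vsub_vadd_mem' := by
    have key : ∀ (c : ℝ) (p q : Rd d), g p ∈ S → g q ∈ S →
        g (AffineMap.lineMap p q c) ∈ S := by
      intro c p q hp hq
      by_cases hpq : p = q
      · subst hpq; simpa using hp
      refine line_closed_of_wbtw g hg hW S p q _ hp hq ?_ hpq
      have : AffineMap.lineMap p q c ∈ line[ℝ, p, q] := AffineMap.lineMap_mem_affineSpan_pair c p q
      have h2 := collinear_insert_of_mem_affineSpan_pair this
      refine h2.subset ?_
      intro y; simp; tauto
    intro c p₁ p₂ p₃ h1 h2 h3
    have hq := key (2 * c) p₂ p₁ h2 h1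
    have hr := key 2 p₂ p₃ h2 h3
    have hm := key (1/2) _ _ hq hr
    have e : c • (p₁ -ᵥ p₂) +ᵥ p₃ = AffineMap.lineMap (AffineMap.lineMap p₂ p₁ (2 * c))
        (AffineMap.lineMap p₂ p₃ (2 : ℝ)) (1/2 : ℝ) := by
      simp only [AffineMap.lineMap_apply, vsub_eq_sub, vadd_eq_add]
      module
    change g _ ∈ S
    rw [e]; exact hm

lemma wbtw_reflect {d : ℕ} (g : Rd d → Rd d) (hg : Function.Bijective g)
    (hW : ∀ p z q, Wbtw ℝ p z q → Wbtw ℝ (g p) (g z) (g q))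
    (a u b : Rd d) (h : Wbtw ℝ (g a) (g u) (g b)) : Wbtw ℝ a u b := by
  by_cases hc : Collinear ℝ ({a, u, b} : Set (Rd d))
  · rcases hc.wbtw_or_wbtw_or_wbtw with h1 | h1 | h1
    · exact h1
    · have h2 := hW _ _ _ h1
      have : g u = g b := h.swap_right_iff.1 h2.symm
      rw [hg.1 this]; simp
    · have h2 := hW _ _ _ h1
      have : g a = g u := h.swap_left_iff.1 h2.symm
      rw [hg.1 this]; simp
  exfalso
  have hi : AffineIndependent ℝ ![a, u, b] := affineIndependent_iff_not_collinear_set.2 hc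
  obtain ⟨t, hst, hti, htop⟩ := exists_subset_affineIndependent_affineSpan_eq_top hi.range
  have hfin : Finite t := finite_set_of_fin_dim_affineIndependent ℝ hti
  have := Fintype.ofFinite t
  have hrange : Set.range ((↑) : t → Rd d) = t := Subtype.range_coe
  have hcard := hti.affineSpan_eq_top_iff_card_eq_finrank_add_one.1 (by rw [hrange]; exact htop)
  have hspan : affineSpan ℝ (Set.range (fun x : t => g x)) = ⊤ := by
    have h1 : affineSpan ℝ t ≤ preSub g hg.1 hW (affineSpan ℝ (Set.range (fun x : t => g x))) := by
      rw [affineSpan_le]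
      intro x hx
      exact subset_affineSpan ℝ _ ⟨⟨x, hx⟩, rfl⟩
    rw [htop] at h1
    rw [eq_top_iff]
    intro y _
    obtain ⟨x, rfl⟩ := hg.2 y
    exact h1 (AffineSubspace.mem_top ℝ _ x)
  have hind : AffineIndependent ℝ (fun x : t => g x) := by
    rw [affineIndependent_iff_finrank_vectorSpan_eq ℝ _ hcard, ← direction_affineSpan, hspan,
      AffineSubspace.direction_top, finrank_top]
  have ht : ∀ i, ![a, u, b] i ∈ t := fun i => hst ⟨i, rfl⟩
  have h3 := hind.comp_embedding (⟨fun i => ⟨![a, u, b] i, ht i⟩, fun i j hij => hi.injective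
    (by simpa using hij)⟩ : Fin 3 ↪ t)
  have h4 : AffineIndependent ℝ ![g a, g u, g b] := by
    convert h3 using 1
    ext i; fin_cases i <;> rfl
  exact affineIndependent_iff_not_collinear_set.1 h4 h.collinear

lemma wbtw_of_conv {d : ℕ} (f : Rd d → Rd d) (hf_bij : Function.Bijective f)
    (hf_conv : ∀ s : Set (Rd d), Convex ℝ s → Convex ℝ (f '' s))
    (a u b : Rd d) (h : Wbtw ℝ a u b) : Wbtw ℝ (f a) (f u) (f b) := by
  let e := Equiv.ofBijective f hf_bij
  have he : ∀ x, e.symm (f x) = x := fun x => e.symm_apply_apply x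
  refine wbtw_reflect e.symm e.symm.bijective ?_ _ _ _ (by simpa only [he] using h)
  intro p z q hz
  obtain ⟨p, rfl⟩ := hf_bij.2 p
  obtain ⟨q, rfl⟩ := hf_bij.2 q
  rw [← mem_segment_iff_wbtw] at hz
  have := (hf_conv _ (convex_segment p q)).segment_subset
    ⟨p, left_mem_segment ℝ p q, rfl⟩ ⟨q, right_mem_segment ℝ p q, rfl⟩ hz
  obtain ⟨w, hw, rfl⟩ := this
  simp only [he]
  exact mem_segment_iff_wbtw.1 hw

lemma image_hull {d : ℕ} (f : Rd d → Rd d) (hf_bij : Function.Bijective f)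
    (hf_conv : ∀ s : Set (Rd d), Convex ℝ s → Convex ℝ (f '' s)) (A : Set (Rd d))
    (x : Rd d) (hx : x ∈ convexHull ℝ A) : f x ∈ convexHull ℝ (f '' A) := by
  have hc : Convex ℝ (f ⁻¹' convexHull ℝ (f '' A)) := by
    rw [convex_iff_segment_subset]
    intro a ha b hb u hu
    exact (convex_convexHull ℝ _).segment_subset ha hb
      (mem_segment_iff_wbtw.2 (wbtw_of_conv f hf_bij hf_conv _ _ _ (mem_segment_iff_wbtw.1 hu)))
  have hsub : A ⊆ f ⁻¹' convexHull ℝ (f '' A) :=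
    fun y hy => subset_convexHull ℝ (f '' A) (Set.mem_image_of_mem f hy)
  exact (convexHull_min hsub hc : convexHull ℝ A ⊆ _) hx

lemma extPts_subset' {d : ℕ} (ω : Set (Rd d)) : extPts ω ⊆ ω :=
  extremePoints_convexHull_subset (𝕜 := ℝ)

lemma hull_extPts {d : ℕ} (ω : Set (Rd d)) (hω : ω.Finite) :
    convexHull ℝ (extPts ω) = convexHull ℝ ω := by
  have h := closure_convexHull_extremePoints (hω.isCompact_convexHull ℝ) (convex_convexHull ℝ ω)
  have h2 : (extPts ω).Finite := hω.subset (extPts_subset' ω)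
  rw [← h]
  exact (h2.isClosed_convexHull ℝ).closure_eq.symm

lemma extPts_not_interior {d : ℕ} (hd : 1 ≤ d) (C : Set (Rd d)) (x : Rd d)
    (hx : x ∈ C.extremePoints ℝ) : x ∉ interior C := by
  intro hi
  have : Nonempty (Fin d) := ⟨⟨0, hd⟩⟩
  obtain ⟨v, hv⟩ := exists_ne (0 : Rd d)
  rw [mem_interior_iff_mem_nhds] at hi
  have h1 : Filter.Tendsto (fun s : ℝ => x + s • v) (nhds 0) (nhds x) := by
    have : Continuous (fun s : ℝ => x + s • v) := by fun_prop
    simpa using this.tendsto 0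
  obtain ⟨ε, hε, hb⟩ := Metric.eventually_nhds_iff.1 (h1.eventually hi)
  have ha : x + (ε/2) • v ∈ C := hb (by simp [abs_of_pos hε]; linarith)
  have hc : x + (-(ε/2)) • v ∈ C := hb (by simp [abs_of_pos hε]; linarith)
  have := hx.2 ha hc ⟨1/2, 1/2, by norm_num, by norm_num, by norm_num, by module⟩
  have h0 : (ε/2) • v = 0 := by simpa using this
  rcases smul_eq_zero.1 h0 with h | h
  · linarith
  · exact hv h

/-- For every `k ≥ 0`, every finite configuration `ω` and every `x ∈ ℝ^d`,
`τ^{(k)}(x,ω) = τ^{(k)}(x,ω_e)`: the iterates depend on `ω` only through `ω_e`. -/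
theorem tauIter_extPts (d : ℕ) (hd : 1 ≤ d)
    (f : Rd d → Rd d) (hf_bij : Function.Bijective f)
    (hf_conv : ∀ s : Set (Rd d), Convex ℝ s → Convex ℝ (f '' s))
    (τhat : Rd d → Set (Rd d) → Rd d)
    (h_ext : ∀ (x : Rd d) (ω : Set (Rd d)), ω.Finite → τhat x ω = τhat x (extPts ω))
    (h_in : ∀ (x : Rd d) (ω : Set (Rd d)), ω.Finite →
      x ∈ interior (convexHull ℝ (extPts ω)) →
      τhat x ω ∈ interior (convexHull ℝ (extPts ω)))
    (h_out : ∀ (x : Rd d) (ω : Set (Rd d)), ω.Finite →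
      x ∉ interior (convexHull ℝ (extPts ω)) → τhat x ω = x)
    (k : ℕ) (ω : Set (Rd d)) (hω : ω.Finite) (x : Rd d) :
    tauIter (fun y ω' => f (τhat y ω')) k x ω
      = tauIter (fun y ω' => f (τhat y ω')) k x (extPts ω) := by
  have hstar : ∀ ω : Set (Rd d), ω.Finite →
      extPts (tauStar (fun y ω' => f (τhat y ω')) ω)
        = extPts (tauStar (fun y ω' => f (τhat y ω')) (extPts ω)) := by
    intro ω hω
    have hfix : ∀ y ∈ extPts ω, τhat y ω = y := by
      intro y hy
      refine h_out y ω hω ?_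
      rw [hull_extPts ω hω]
      exact extPts_not_interior hd _ y hy
    have hR : tauStar (fun y ω' => f (τhat y ω')) (extPts ω) = f '' extPts ω := by
      refine Set.image_congr ?_
      intro y hy
      simp only [← h_ext y ω hω, hfix y hy]
    have hmem : ∀ y ∈ ω, τhat y ω ∈ convexHull ℝ (extPts ω) := by
      intro y hy
      by_cases hi : y ∈ interior (convexHull ℝ (extPts ω))
      · exact interior_subset (h_in y ω hω hi)
      · rw [h_out y ω hω hi, hull_extPts ω hω]
        exact subset_convexHull ℝ _ hy
    unfold extPts
    congr 1
    change _ = convexHull ℝ (tauStar (fun y ω' => f (τhat y ω')) (extPts ω))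
    rw [hR]
    apply Set.Subset.antisymm
    · refine convexHull_min ?_ (convex_convexHull ℝ _)
      rintro _ ⟨y, hy, rfl⟩
      exact image_hull f hf_bij hf_conv _ _ (hmem y hy)
    · refine convexHull_mono ?_
      rintro _ ⟨y, hy, rfl⟩
      exact ⟨y, extPts_subset' ω hy, by simp only [hfix y hy]⟩
  induction k generalizing ω x with
  | zero => rfl
  | succ k ih =>
    simp only [tauIter]
    have f1 : (tauStar (fun y ω' => f (τhat y ω')) ω).Finite := hω.image _
    have f2 : (tauStar (fun y ω' => f (τhat y ω')) (extPts ω)).Finite :=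
      (hω.subset (extPts_subset' ω)).image _
    rw [← h_ext x ω hω, ih _ f1, hstar ω hω, ← ih _ f2]
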